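/- Let N ≥ 2 and let Ω_ε⁺ = B((1-ε,0),1) ∩ {x_1 > 0} ⊆ ℝ^N. Then there is γ > 0 such that for all sufficiently small ε > 0, λ_1(Ω_ε⁺) ≤ λ_1(B) + γ ε^{(N+1)/2}. -/

import Mathlib

open MeasureTheory Metric Set Filter Pointwise

noncomputable section

/-- Test functions for the Dirichlet problem on `Ω`: smooth, compactly supported,
with support inside `Ω`. These are dense in `H¹₀(Ω)`. -/
def testFun (N : ℕ) (Ω : Set (EuclideanSpace ℝ (Fin N))) :
    Set (EuclideanSpace ℝ (Fin N) → ℝ) :=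
  {u | ContDiff ℝ (⊤ : ℕ∞) u ∧ HasCompactSupport u ∧ tsupport u ⊆ Ω}

/-- The Rayleigh quotient `‖∇u‖²_{L²} / ‖u‖²_{L²}`. -/
def rayleigh (N : ℕ) (u : EuclideanSpace ℝ (Fin N) → ℝ) : ℝ :=
  (∫ x, ‖fderiv ℝ u x‖ ^ 2) / (∫ x, (u x) ^ 2)

/-- The `k`-th Dirichlet-Laplacian eigenvalue (k = 1, 2, ...) of an open set `Ω ⊆ ℝ^N`,
via the Courant–Fischer min-max characterization over `k`-dimensional subspaces of
test functions. -/
def dirichletEV (N : ℕ) (k : ℕ) (Ω : Set (EuclideanSpace ℝ (Fin N))) : ℝ :=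
  sInf {t : ℝ | ∃ V : Submodule ℝ (EuclideanSpace ℝ (Fin N) → ℝ),
    Module.finrank ℝ V = k ∧ (V : Set _) ⊆ testFun N Ω ∪ {0} ∧
    ∀ u ∈ V, u ≠ 0 → rayleigh N u ≤ t}

/-- `ω_N`, the volume of the unit ball in `ℝ^N`, as a real number. -/
def unitBallVol (N : ℕ) : ℝ :=
  (volume (ball (0 : EuclideanSpace ℝ (Fin N)) 1)).toReal

/-- The termwise derivative of a power series with coefficients `a`. -/
def derivCoeff (a : ℕ → ℝ) (k : ℕ) : ℝ := (k + 1) * a (k + 1)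

lemma abs_derivCoeff_le {a : ℕ → ℝ} (ha : ∀ k, |a k| ≤ 1 / (k.factorial : ℝ)) (k : ℕ) :
    |derivCoeff a k| ≤ 1 / (k.factorial : ℝ) := by
  have h := ha (k + 1)
  have hk : (0 : ℝ) < (k : ℝ) + 1 := by positivity
  have hf : (0 : ℝ) < (k.factorial : ℝ) := by positivity
  rw [derivCoeff, abs_mul, abs_of_pos hk]
  rw [Nat.factorial_succ] at h
  push_cast at h
  calc ((k : ℝ) + 1) * |a (k + 1)| ≤ ((k : ℝ) + 1) * (1 / (((k : ℝ) + 1) * k.factorial)) := by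
        gcongr
    _ = 1 / (k.factorial : ℝ) := by field_simp

lemma summable_mul_pow_of_abs_le_inv_factorial {a : ℕ → ℝ}
    (ha : ∀ k, |a k| ≤ 1 / (k.factorial : ℝ)) (s : ℝ) : Summable fun k => a k * s ^ k := by
  refine Summable.of_norm_bounded (Real.summable_pow_div_factorial |s|) fun k => ?_
  rw [Real.norm_eq_abs, abs_mul, abs_pow]
  calc |a k| * |s| ^ k ≤ 1 / (k.factorial : ℝ) * |s| ^ k := by gcongr; exact ha k
    _ = |s| ^ k / k.factorial := by ring

lemma hasDerivAt_tsum_mul_pow {a : ℕ → ℝ}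
    (ha : ∀ k, |a k| ≤ 1 / (k.factorial : ℝ)) (s : ℝ) :
    HasDerivAt (fun s => ∑' k, a k * s ^ k) (∑' k, derivCoeff a k * s ^ k) s := by
  set R : ℝ := |s| + 1
  have hb : Summable fun k => 1 / ((k - 1).factorial : ℝ) * R ^ (k - 1) := by
    rw [← summable_nat_add_iff 1]
    refine (Real.summable_pow_div_factorial R).congr fun k => ?_
    simp only [Nat.add_sub_cancel]
    ring
  have h := hasDerivAt_tsum_of_isPreconnected (t := ball (0 : ℝ) R) (y := s) (y₀ := 0)
    (g := fun k s => a k * s ^ k) (g' := fun k s => a k * (k * s ^ (k - 1))) hb isOpen_ball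
    (convex_ball _ _).isPreconnected (fun k y _ => (hasDerivAt_pow k y).const_mul _) ?_
    (by simp [R]; positivity) (summable_mul_pow_of_abs_le_inv_factorial ha 0)
    (by simp [R])
  · refine h.congr_deriv ?_
    have hs : Summable fun k => a k * ((k : ℝ) * s ^ (k - 1)) := by
      rw [← summable_nat_add_iff 1]
      refine (summable_mul_pow_of_abs_le_inv_factorial (abs_derivCoeff_le ha) s).congr fun k => ?_
      simp only [derivCoeff, Nat.add_sub_cancel]
      push_cast
      ring
    rw [hs.tsum_eq_zero_add]
    simp only [CharP.cast_eq_zero, zero_mul, mul_zero, zero_add, Nat.add_sub_cancel]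
    refine tsum_congr fun k => ?_
    simp only [derivCoeff]
    push_cast
    ring
  · intro k y hy
    rcases k with _ | k
    · simp
    · have hy' : |y| ≤ R := by
        have := mem_ball_zero_iff.1 hy
        exact this.le
      have h := abs_derivCoeff_le ha k
      simp only [Nat.add_sub_cancel, Real.norm_eq_abs]
      calc |a (k + 1) * (((k + 1 : ℕ) : ℝ) * y ^ k)| = |derivCoeff a k| * |y| ^ k := by
            rw [derivCoeff, ← abs_pow, ← abs_mul]
            push_cast
            ring_nf
        _ ≤ _ := by gcongr

lemma contDiff_tsum_mul_pow {a : ℕ → ℝ} (ha : ∀ k, |a k| ≤ 1 / (k.factorial : ℝ)) :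
    ContDiff ℝ (⊤ : ℕ∞) fun s => ∑' k, a k * s ^ k := by
  rw [contDiff_infty]
  intro n
  induction n generalizing a with
  | zero =>
    exact contDiff_zero.2 (continuous_iff_continuousAt.2 fun s =>
      (hasDerivAt_tsum_mul_pow ha s).continuousAt)
  | succ n ih =>
    push_cast
    refine contDiff_succ_iff_deriv.2
      ⟨fun s => (hasDerivAt_tsum_mul_pow ha s).differentiableAt, by simp, ?_⟩
    rw [funext fun s => (hasDerivAt_tsum_mul_pow ha s).deriv]
    exact ih (abs_derivCoeff_le ha)

/-- The Taylor coefficients of the regular solution of `4 s G'' + 2 d G' = -G`. -/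
def radialCoeff (d : ℝ) : ℕ → ℝ
  | 0 => 1
  | k + 1 => -radialCoeff d k / ((k + 1) * (4 * k + 2 * d))

lemma abs_radialCoeff_le {d : ℝ} (hd : 1 ≤ d) (k : ℕ) :
    |radialCoeff d k| ≤ 1 / (k.factorial : ℝ) := by
  induction k with
  | zero => simp [radialCoeff]
  | succ k ih =>
    have hk : (0 : ℝ) ≤ k := by positivity
    have hf : (0 : ℝ) < (k.factorial : ℝ) := by positivity
    have hpos : (0 : ℝ) < (k + 1) * (4 * k + 2 * d) := by positivity
    rw [radialCoeff, abs_div, abs_neg, abs_of_pos hpos, Nat.factorial_succ]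
    push_cast
    rw [← div_div, ← div_div, div_div 1, mul_comm _ (k.factorial : ℝ), ← div_div]
    calc |radialCoeff d k| / (k + 1) / (4 * k + 2 * d) ≤ |radialCoeff d k| / (k + 1) :=
          div_le_self (by positivity) (by linarith)
      _ ≤ _ := by gcongr

/-- The entire radial profile of the eigenfunctions of the Laplacian in dimension `d`. -/
lemma exists_radial_profile {d : ℝ} (hd : 1 ≤ d) :
    ∃ G : ℝ → ℝ, ContDiff ℝ (⊤ : ℕ∞) G ∧ G 0 = 1 ∧
      ∀ s, 4 * s * deriv (deriv G) s + 2 * d * deriv G s = -G s := by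
  set a := radialCoeff d
  have ha := abs_radialCoeff_le hd
  have hb := abs_derivCoeff_le ha
  have hc := abs_derivCoeff_le hb
  refine ⟨fun s => ∑' k, a k * s ^ k, contDiff_tsum_mul_pow ha, ?_, fun s => ?_⟩
  · beta_reduce
    rw [tsum_eq_single 0 (fun k hk => by simp [hk])]
    simp [a, radialCoeff]
  · rw [funext fun s => (hasDerivAt_tsum_mul_pow ha s).deriv,
      (hasDerivAt_tsum_mul_pow hb s).deriv]
    have h1 := (summable_mul_pow_of_abs_le_inv_factorial ha s).hasSum
    have h2 := (summable_mul_pow_of_abs_le_inv_factorial hb s).hasSum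
    have h3 := (summable_mul_pow_of_abs_le_inv_factorial hc s).hasSum
    have h4 : HasSum (fun k : ℕ => (k : ℝ) * derivCoeff a k * s ^ k)
        (s * ∑' k, derivCoeff (derivCoeff a) k * s ^ k) := by
      rw [← hasSum_nat_add_iff' 1]
      simp only [Finset.range_one, Finset.sum_singleton, CharP.cast_eq_zero, zero_mul, sub_zero]
      refine (h3.mul_left s).congr_fun fun k => ?_
      rw [derivCoeff.eq_1 (derivCoeff a)]
      push_cast
      ring
    have h5 := ((h4.mul_left 4).add (h2.mul_left (2 * d))).add h1
    have h6 : HasSum (fun _ : ℕ => (0 : ℝ)) 0 := hasSum_zero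
    have h7 := h5.unique (h6.congr_fun ?_)
    · linarith
    · intro k
      have hpos : ((k : ℝ) + 1) * (4 * k + 2 * d) ≠ 0 := by positivity
      simp only [derivCoeff, a, radialCoeff]
      field_simp
      ring

/-- The ground state substitution: if `Δ u = -m u` then, for compactly supported `w`,
`∫ |∇(u w)|² = m ∫ (u w)² + ∫ u² |∇w|²`. -/
lemma integral_sq_norm_fderiv_mul {ι E : Type*} [Fintype ι] [NormedAddCommGroup E]
    [InnerProductSpace ℝ E] [FiniteDimensional ℝ E] [MeasurableSpace E] [BorelSpace E]
    (ν : Measure E) [ν.IsAddHaarMeasure] (b : OrthonormalBasis ι ℝ E) {u w : E → ℝ} {m : ℝ}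
    (hu : ContDiff ℝ 2 u) (hw : ContDiff ℝ 1 w) (hwc : HasCompactSupport w)
    (hΔ : ∀ x, ∑ i, fderiv ℝ (fun y => fderiv ℝ u y (b i)) x (b i) = -(m * u x)) :
    ∫ x, ‖fderiv ℝ (fun y => u y * w y) x‖ ^ 2 ∂ν =
      m * ∫ x, (u x * w x) ^ 2 ∂ν + ∫ x, u x ^ 2 * ‖fderiv ℝ w x‖ ^ 2 ∂ν := by
  have hu1 : ContDiff ℝ 1 u := hu.of_le one_le_two
  have hud : Differentiable ℝ u := hu1.differentiable one_ne_zero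
  have hwd : Differentiable ℝ w := hw.differentiable one_ne_zero
  have hdw : Continuous (fderiv ℝ w) := hw.continuous_fderiv one_ne_zero
  have hdu : ∀ i, ContDiff ℝ 1 fun y => fderiv ℝ u y (b i) := fun i =>
    (hu.fderiv_right (m := 1) (by norm_num)).clm_apply contDiff_const
  set g : E → ℝ := fun y => u y * w y ^ 2
  have hg : ContDiff ℝ 1 g := hu1.mul (hw.pow 2)
  have hgc : HasCompactSupport g := by
    refine hwc.mono fun x hx => ?_
    contrapose! hx
    simp only [Function.mem_support, not_not] at hx
    simp [g, hx]
  have hgd : Differentiable ℝ g := hg.differentiable one_ne_zero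
  have hdg : ∀ i, Continuous fun x => fderiv ℝ g x (b i) := fun i =>
    (hg.continuous_fderiv one_ne_zero).clm_apply continuous_const
  have hdgc : ∀ i, HasCompactSupport fun x => fderiv ℝ g x (b i) := fun i =>
    hgc.fderiv_apply ℝ (b i)
  have hddu : ∀ i, Continuous fun x => fderiv ℝ (fun y => fderiv ℝ u y (b i)) x (b i) := fun i =>
    ((hdu i).continuous_fderiv one_ne_zero).clm_apply continuous_const
  have hI1 : ∀ i, Integrable (fun x => fderiv ℝ u x (b i) * fderiv ℝ g x (b i)) ν := fun i =>
    ((hdu i).continuous.mul (hdg i)).integrable_of_hasCompactSupport (hdgc i).mul_left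
  have hI2 : ∀ i, Integrable
      (fun x => fderiv ℝ (fun y => fderiv ℝ u y (b i)) x (b i) * g x) ν := fun i =>
    ((hddu i).mul hg.continuous).integrable_of_hasCompactSupport hgc.mul_left
  have hI3 : Integrable (fun x => u x ^ 2 * ‖fderiv ℝ w x‖ ^ 2) ν := by
    refine ((hu.continuous.pow 2).mul (hdw.norm.pow 2)).integrable_of_hasCompactSupport ?_
    refine (hwc.fderiv ℝ).mono fun x hx => ?_
    contrapose! hx
    simp only [Function.mem_support, not_not] at hx
    simp [hx]
  have hparts : ∀ i, ∫ x, fderiv ℝ u x (b i) * fderiv ℝ g x (b i) ∂ν =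
      -∫ x, fderiv ℝ (fun y => fderiv ℝ u y (b i)) x (b i) * g x ∂ν := fun i =>
    integral_mul_fderiv_eq_neg_fderiv_mul_of_integrable (hI2 i) (hI1 i)
      (((hdu i).continuous.mul hg.continuous).integrable_of_hasCompactSupport hgc.mul_left)
      (fun x _ => (hdu i).differentiable one_ne_zero x) (fun x _ => hgd x)
  have hcross : ∫ x, ∑ i, fderiv ℝ u x (b i) * fderiv ℝ g x (b i) ∂ν =
      m * ∫ x, (u x * w x) ^ 2 ∂ν := by
    rw [integral_finsetSum _ fun i _ => hI1 i, Finset.sum_congr rfl fun i _ => hparts i,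
      Finset.sum_neg_distrib, ← integral_finsetSum _ fun i _ => hI2 i, ← integral_neg,
      ← integral_const_mul]
    congr 1
    funext x
    rw [← Finset.sum_mul, hΔ]
    simp only [g]
    ring
  rw [← hcross, ← integral_add (integrable_finsetSum _ fun i _ => hI1 i) hI3]
  congr 1
  funext x
  have h1 : fderiv ℝ (fun y => u y * w y) x = u x • fderiv ℝ w x + w x • fderiv ℝ u x :=
    fderiv_fun_mul (hud x) (hwd x)
  have h2 : fderiv ℝ g x = u x • ((2 * w x) • fderiv ℝ w x) + (w x ^ 2) • fderiv ℝ u x := by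
    have h := ((hud x).hasFDerivAt.mul ((hwd x).hasFDerivAt.pow 2)).fderiv
    refine h.trans ?_
    ext v
    simp
  rw [b.norm_dual, b.norm_dual, Finset.mul_sum, ← Finset.sum_add_distrib]
  refine Finset.sum_congr rfl fun i _ => ?_
  rw [h1, h2]
  simp only [add_apply, FunLike.coe_smul, Pi.smul_apply, smul_eq_mul]
  ring

/-- The Laplacian of a radial function. -/
lemma sum_fderiv_fderiv_radial {ι E : Type*} [Fintype ι] [NormedAddCommGroup E]
    [InnerProductSpace ℝ E] (b : OrthonormalBasis ι ℝ E) {F : ℝ → ℝ} (hF : ContDiff ℝ 2 F)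
    (x : E) :
    ∑ i, fderiv ℝ (fun y => fderiv ℝ (fun z => F (‖z‖ ^ 2)) y (b i)) x (b i) =
      4 * ‖x‖ ^ 2 * deriv (deriv F) (‖x‖ ^ 2) + 2 * Fintype.card ι * deriv F (‖x‖ ^ 2) := by
  have hF1 : Differentiable ℝ F := hF.differentiable two_ne_zero
  have hF2 : Differentiable ℝ (deriv F) :=
    ((contDiff_succ_iff_deriv (n := 1)).1 hF).2.2.differentiable one_ne_zero
  have hq : ∀ y : E, HasFDerivAt (fun z : E => ‖z‖ ^ 2) (2 • innerSL ℝ y) y := fun y =>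
    (hasStrictFDerivAt_norm_sq y).hasFDerivAt
  have h1 : ∀ i, (fun y => fderiv ℝ (fun z => F (‖z‖ ^ 2)) y (b i)) =
      fun y => deriv F (‖y‖ ^ 2) * (2 * inner ℝ (b i) y) := by
    intro i
    funext y
    refine (congrArg (fun L => L (b i))
      ((hF1 (‖y‖ ^ 2)).hasDerivAt.comp_hasFDerivAt y (hq y)).fderiv).trans ?_
    simp [real_inner_comm]
  have h2 : ∀ i, fderiv ℝ (fun y => deriv F (‖y‖ ^ 2) * (2 * inner ℝ (b i) y)) x (b i) =
      4 * deriv (deriv F) (‖x‖ ^ 2) * ‖inner ℝ (b i) x‖ ^ 2 + 2 * deriv F (‖x‖ ^ 2) := by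
    intro i
    have h := ((hF2 (‖x‖ ^ 2)).hasDerivAt.comp_hasFDerivAt x (hq x)).mul
      (((innerSL ℝ (b i)).hasFDerivAt (x := x)).const_mul 2)
    refine (congrArg (fun L => L (b i)) h.fderiv).trans ?_
    simp [real_inner_comm]
    ring
  rw [Finset.sum_congr rfl fun i _ => (congrArg (fun f => fderiv ℝ f x (b i)) (h1 i)).trans (h2 i),
    Finset.sum_add_distrib, ← Finset.mul_sum, b.sum_sq_norm_inner_right]
  simp
  ring

/-- Barta's inequality: a positive radial solution of `Δ u = -m u` on the unit ball bounds the
Dirichlet energy from below. -/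
lemma mul_integral_sq_le_of_radial_pos {N : ℕ} {F : ℝ → ℝ} {m : ℝ}
    (hF : ContDiff ℝ (⊤ : ℕ∞) F) (hpos : ∀ s ∈ Ico (0 : ℝ) 1, 0 < F s)
    (hode : ∀ s, 4 * s * deriv (deriv F) s + 2 * N * deriv F s = -(m * F s))
    {φ : EuclideanSpace ℝ (Fin N) → ℝ} (hφ : φ ∈ testFun N (ball 0 1)) :
    m * ∫ x, φ x ^ 2 ≤ ∫ x, ‖fderiv ℝ φ x‖ ^ 2 := by
  obtain ⟨hφs, hφc, hφt⟩ := hφ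
  have hF2 : ContDiff ℝ 2 F := by exact_mod_cast contDiff_infty.1 hF 2
  set u : EuclideanSpace ℝ (Fin N) → ℝ := fun x => F (‖x‖ ^ 2)
  have hu : ContDiff ℝ 2 u := hF2.comp (contDiff_norm_sq ℝ)
  have hupos : ∀ x ∈ ball (0 : EuclideanSpace ℝ (Fin N)) 1, 0 < u x := by
    intro x hx
    rw [mem_ball_zero_iff] at hx
    exact hpos _ ⟨by positivity, by nlinarith [norm_nonneg x]⟩
  have hw : ContDiff ℝ 1 fun x => φ x / u x := by
    rw [contDiff_iff_contDiffAt]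
    intro x
    by_cases hx : x ∈ tsupport φ
    · exact (hφs.of_le (by exact_mod_cast le_top)).contDiffAt.div
        (hu.of_le one_le_two).contDiffAt (hupos x (hφt hx)).ne'
    · refine (contDiffAt_const (c := (0 : ℝ))).congr_of_eventuallyEq ?_
      filter_upwards [notMem_tsupport_iff_eventuallyEq.1 hx] with y hy
      simp [hy]
  have hwc : HasCompactSupport fun x => φ x / u x := by
    refine hφc.mono fun x hx => ?_
    contrapose! hx
    simp only [Function.mem_support, not_not] at hx
    simp [hx]
  have huw : (fun x => u x * (φ x / u x)) = φ := by
    funext x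
    by_cases hx : x ∈ tsupport φ
    · have := (hupos x (hφt hx)).ne'
      field_simp
    · simp [image_eq_zero_of_notMem_tsupport hx]
  have h := integral_sq_norm_fderiv_mul volume (EuclideanSpace.basisFun (Fin N) ℝ) (m := m) hu hw
    hwc fun x => by
      rw [sum_fderiv_fderiv_radial _ hF2, Fintype.card_fin]
      exact hode _
  rw [huw] at h
  have huw' : ∀ x, u x * (φ x / u x) = φ x := fun x => congrFun huw x
  simp only [huw'] at h
  rw [h]
  have : 0 ≤ ∫ x, u x ^ 2 * ‖fderiv ℝ (fun x => φ x / u x) x‖ ^ 2 :=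
    integral_nonneg fun x => by positivity
  linarith

lemma exists_testFun_ne_zero (N : ℕ) :
    ∃ φ ∈ testFun N (ball 0 1), φ ≠ 0 := by
  obtain ⟨φ, h1, h2, h3, -, h5⟩ := exists_contDiff_tsupport_subset (n := ⊤)
    (ball_mem_nhds (0 : EuclideanSpace ℝ (Fin N)) one_pos)
  exact ⟨φ, ⟨h3, h2, h1⟩, fun h => by simp [h] at h5⟩

lemma integral_sq_pos_of_mem_testFun {N : ℕ} {Ω : Set (EuclideanSpace ℝ (Fin N))}
    {φ : EuclideanSpace ℝ (Fin N) → ℝ} (hφ : φ ∈ testFun N Ω) (h0 : φ ≠ 0) :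
    0 < ∫ x, φ x ^ 2 := by
  obtain ⟨x, hx⟩ := Function.ne_iff.1 h0
  refine (hφ.1.continuous.pow 2).integral_pos_of_hasCompactSupport_nonneg_nonzero (x := x)
    (hφ.2.1.mono fun y hy => ?_) (fun y => sq_nonneg _) (by simpa using hx)
  contrapose! hy
  simp only [Function.mem_support, not_not] at hy
  simp [hy]

/-- The radial profile, in the variable `‖x‖²`, of the first eigenfunction of the unit ball. -/
lemma exists_ground_state_profile {N : ℕ} (hN : 1 ≤ N) :
    ∃ (F : ℝ → ℝ) (m : ℝ), ContDiff ℝ (⊤ : ℕ∞) F ∧ F 1 = 0 ∧ (∀ s ∈ Ico (0 : ℝ) 1, 0 < F s) ∧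
      ∀ s, 4 * s * deriv (deriv F) s + 2 * N * deriv F s = -(m * F s) := by
  obtain ⟨G, hG, hG0, hode⟩ := exists_radial_profile (d := N) (by exact_mod_cast hN)
  have hd : ∀ m : ℝ, deriv (fun s => G (m * s)) = fun s => m * deriv G (m * s) := fun m => by
    funext s
    simpa using deriv_comp_mul_left m G s
  have hscale : ∀ m s : ℝ, 4 * s * deriv (deriv fun s => G (m * s)) s +
      2 * N * deriv (fun s => G (m * s)) s = -(m * G (m * s)) := by
    intro m s
    have h2 : deriv (fun s => m * deriv G (m * s)) s = m * (m * deriv (deriv G) (m * s)) := by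
      rw [deriv_const_mul_field, deriv_comp_mul_left m (deriv G) s, smul_eq_mul]
    rw [hd, h2]
    linear_combination m * hode (m * s)
  have hsmooth : ∀ m : ℝ, ContDiff ℝ (⊤ : ℕ∞) fun s => G (m * s) := fun m =>
    hG.comp (contDiff_const.mul contDiff_id)
  set Z : Set ℝ := {s | 0 ≤ s ∧ G s = 0}
  have hpos_of : ∀ t : ℝ, (∀ s ∈ Ico 0 t, s ∉ Z) → ∀ s ∈ Ico 0 t, 0 < G s := by
    intro t ht s hs
    by_contra! hneg
    obtain ⟨r, hr, hr0⟩ := intermediate_value_Icc' hs.1 hG.continuous.continuousOn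
      (show (0 : ℝ) ∈ Icc (G s) (G 0) from ⟨hneg, by rw [hG0]; exact zero_le_one⟩)
    exact ht r ⟨hr.1, hr.2.trans_lt hs.2⟩ ⟨hr.1, hr0⟩
  have hZne : Z.Nonempty := by
    by_contra hZ
    rw [not_nonempty_iff_eq_empty] at hZ
    obtain ⟨φ, hφ, hφ0⟩ := exists_testFun_ne_zero N
    have hφpos := integral_sq_pos_of_mem_testFun hφ hφ0
    set m : ℝ := (∫ x, ‖fderiv ℝ φ x‖ ^ 2) / (∫ x, φ x ^ 2) + 1
    have hm : 0 < m := by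
      have : 0 ≤ ∫ x, ‖fderiv ℝ φ x‖ ^ 2 := integral_nonneg fun x => by positivity
      positivity
    have h := mul_integral_sq_le_of_radial_pos (hsmooth m) (fun s hs => ?_) (hscale m) hφ
    · simp only [m, add_mul, one_mul, div_mul_cancel₀ _ hφpos.ne'] at h
      linarith
    · exact hpos_of (m * s + 1) (by simp [hZ]) _ ⟨mul_nonneg hm.le hs.1, by linarith⟩
  have hZc : IsClosed Z := isClosed_Ici.inter (isClosed_eq hG.continuous continuous_const)
  have hZb : BddBelow Z := ⟨0, fun s hs => hs.1⟩
  have hmZ : sInf Z ∈ Z := hZc.csInf_mem hZne hZb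
  have hm : 0 < sInf Z := by
    refine hmZ.1.lt_of_ne fun h => ?_
    have := hmZ.2
    rw [← h, hG0] at this
    exact one_ne_zero this
  refine ⟨fun s => G (sInf Z * s), sInf Z, hsmooth _, by simpa using hmZ.2, fun s hs => ?_,
    hscale _⟩
  refine hpos_of (sInf Z) (fun r hr hrZ => (csInf_le hZb hrZ).not_gt hr.2) _
    ⟨mul_nonneg hm.le hs.1, ?_⟩
  nlinarith [hs.2]

lemma rayleigh_smul {N : ℕ} (φ : EuclideanSpace ℝ (Fin N) → ℝ) {c : ℝ} (hc : c ≠ 0) :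
    rayleigh N (c • φ) = rayleigh N φ := by
  have h1 : ∀ x, ‖fderiv ℝ (c • φ) x‖ ^ 2 = c ^ 2 * ‖fderiv ℝ φ x‖ ^ 2 := fun x => by
    rw [fderiv_const_smul_field, Pi.smul_apply, norm_smul, mul_pow, Real.norm_eq_abs, sq_abs]
  have h2 : ∀ x, (c • φ) x ^ 2 = c ^ 2 * φ x ^ 2 := fun x => by
    rw [Pi.smul_apply, smul_eq_mul, mul_pow]
  simp only [rayleigh, h1, h2, integral_const_mul]
  exact mul_div_mul_left _ _ (pow_ne_zero 2 hc)

lemma rayleigh_nonneg {N : ℕ} (φ : EuclideanSpace ℝ (Fin N) → ℝ) : 0 ≤ rayleigh N φ :=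
  div_nonneg (integral_nonneg fun x => by positivity) (integral_nonneg fun x => by positivity)

lemma smul_mem_testFun {N : ℕ} {Ω : Set (EuclideanSpace ℝ (Fin N))}
    {φ : EuclideanSpace ℝ (Fin N) → ℝ} (hφ : φ ∈ testFun N Ω) (c : ℝ) :
    c • φ ∈ testFun N Ω := by
  obtain ⟨h1, h2, h3⟩ := hφ
  refine ⟨contDiff_const.smul h1, h2.smul_left (f := fun _ => c), ?_⟩
  exact (tsupport_smul_subset_right (fun _ => c) φ).trans h3

lemma mem_eigenvalue_bounds {N : ℕ} {Ω : Set (EuclideanSpace ℝ (Fin N))}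
    {φ : EuclideanSpace ℝ (Fin N) → ℝ} (hφ : φ ∈ testFun N Ω) (h0 : φ ≠ 0) :
    rayleigh N φ ∈ {t : ℝ | ∃ V : Submodule ℝ (EuclideanSpace ℝ (Fin N) → ℝ),
      Module.finrank ℝ V = 1 ∧ (V : Set _) ⊆ testFun N Ω ∪ {0} ∧
      ∀ u ∈ V, u ≠ 0 → rayleigh N u ≤ t} := by
  refine ⟨Submodule.span ℝ {φ}, finrank_span_singleton h0, fun u hu => ?_, fun u hu hu0 => ?_⟩
  · obtain ⟨c, rfl⟩ := Submodule.mem_span_singleton.1 hu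
    exact Or.inl (smul_mem_testFun hφ c)
  · obtain ⟨c, rfl⟩ := Submodule.mem_span_singleton.1 hu
    refine (rayleigh_smul φ fun hc => hu0 ?_).le
    rw [hc, zero_smul]

lemma exists_rayleigh_le_of_bound {N : ℕ} {Ω : Set (EuclideanSpace ℝ (Fin N))} {t : ℝ}
    (ht : ∃ V : Submodule ℝ (EuclideanSpace ℝ (Fin N) → ℝ),
      Module.finrank ℝ V = 1 ∧ (V : Set _) ⊆ testFun N Ω ∪ {0} ∧
      ∀ u ∈ V, u ≠ 0 → rayleigh N u ≤ t) :
    ∃ φ ∈ testFun N Ω, φ ≠ 0 ∧ rayleigh N φ ≤ t := by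
  obtain ⟨V, hV, hVs, hVt⟩ := ht
  obtain ⟨v, hv, -⟩ := finrank_eq_one_iff'.1 hV
  have hv0 : (v : EuclideanSpace ℝ (Fin N) → ℝ) ≠ 0 := fun h => hv (Subtype.ext h)
  exact ⟨v, (hVs v.2).resolve_right hv0, hv0, hVt v v.2 hv0⟩

lemma dirichletEV_one_le_rayleigh {N : ℕ} {Ω : Set (EuclideanSpace ℝ (Fin N))}
    {φ : EuclideanSpace ℝ (Fin N) → ℝ} (hφ : φ ∈ testFun N Ω) (h0 : φ ≠ 0) :
    dirichletEV N 1 Ω ≤ rayleigh N φ := by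
  refine csInf_le ⟨0, fun t ht => ?_⟩ (mem_eigenvalue_bounds hφ h0)
  obtain ⟨ψ, -, -, hψ⟩ := exists_rayleigh_le_of_bound ht
  exact (rayleigh_nonneg ψ).trans hψ

lemma le_dirichletEV_one_of_forall {N : ℕ} {Ω : Set (EuclideanSpace ℝ (Fin N))} {m : ℝ}
    (hne : ∃ φ ∈ testFun N Ω, φ ≠ 0)
    (h : ∀ φ ∈ testFun N Ω, φ ≠ 0 → m ≤ rayleigh N φ) : m ≤ dirichletEV N 1 Ω := by
  obtain ⟨φ, hφ, hφ0⟩ := hne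
  refine le_csInf ⟨_, mem_eigenvalue_bounds hφ hφ0⟩ fun t ht => ?_
  obtain ⟨ψ, hψ, hψ0, hψt⟩ := exists_rayleigh_le_of_bound ht
  exact (h ψ hψ hψ0).trans hψt

lemma rayleigh_comp_sub {N : ℕ} (φ : EuclideanSpace ℝ (Fin N) → ℝ)
    (c : EuclideanSpace ℝ (Fin N)) : rayleigh N (fun x => φ (x - c)) = rayleigh N φ := by
  have h : ∀ x, ‖fderiv ℝ (fun x => φ (x - c)) x‖ ^ 2 = ‖fderiv ℝ φ (x - c)‖ ^ 2 := fun x => by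
    rw [fderiv_comp_sub]
  simp only [rayleigh, h]
  rw [integral_sub_right_eq_self (fun x => ‖fderiv ℝ φ x‖ ^ 2) c,
    integral_sub_right_eq_self (fun x => φ x ^ 2) c]

lemma comp_sub_mem_testFun {N : ℕ} {Ω : Set (EuclideanSpace ℝ (Fin N))}
    {φ : EuclideanSpace ℝ (Fin N) → ℝ} (hφ : φ ∈ testFun N Ω) (c : EuclideanSpace ℝ (Fin N)) :
    (fun x => φ (x - c)) ∈ testFun N ((fun x => x - c) ⁻¹' Ω) := by
  obtain ⟨h1, h2, h3⟩ := hφ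
  refine ⟨h1.comp (contDiff_id.sub contDiff_const),
    h2.comp_homeomorph (Homeomorph.subRight c), ?_⟩
  refine (tsupport_comp_subset_preimage φ (continuous_id.sub continuous_const)).trans ?_
  exact preimage_mono h3

lemma volume_real_cap_le {N : ℕ} [NeZero N] {ε : ℝ} (hε : 0 < ε) (hε2 : ε ≤ 1 / 2) :
    volume.real (ball (0 : EuclideanSpace ℝ (Fin N)) 1 ∩ {x | x 0 ≤ -1 + 2 * ε}) ≤
      2 * 4 ^ (N - 1) * ε ^ (((N : ℝ) + 1) / 2) := by
  set r : Fin N → ℝ := fun i => if i = 0 then -1 else -(2 * √ε)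
  set R : Fin N → ℝ := fun i => if i = 0 then -1 + 2 * ε else 2 * √ε
  have hsub : ball (0 : EuclideanSpace ℝ (Fin N)) 1 ∩ {x | x 0 ≤ -1 + 2 * ε} ⊆
      WithLp.ofLp ⁻¹' Icc r R := by
    rintro x ⟨hx, hx0⟩
    rw [mem_ball_zero_iff] at hx
    simp only [mem_ofPred_eq] at hx0
    have hsum : ‖x‖ ^ 2 = x 0 ^ 2 + ∑ i ∈ Finset.univ.erase 0, x i ^ 2 := by
      simp [EuclideanSpace.norm_sq_eq]
    have hle : ‖x‖ ^ 2 < 1 := by nlinarith [norm_nonneg x]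
    have h0 : -1 ≤ x 0 := by
      have : 0 ≤ ∑ i ∈ Finset.univ.erase 0, x i ^ 2 := Finset.sum_nonneg fun i _ => sq_nonneg _
      nlinarith
    have hi : ∀ i, i ≠ 0 → |x i| ≤ 2 * √ε := by
      intro i hi
      have : x i ^ 2 ≤ ∑ i ∈ Finset.univ.erase 0, x i ^ 2 :=
        Finset.single_le_sum (f := fun i => x i ^ 2) (fun i _ => sq_nonneg _) (by simp [hi])
      refine abs_le_of_sq_le_sq ?_ (by positivity)
      rw [mul_pow, Real.sq_sqrt hε.le]
      nlinarith
    refine ⟨fun i => ?_, fun i => ?_⟩ <;> by_cases h : i = 0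
    · simpa [r, h] using h0
    · simpa [r, h] using (abs_le.1 (hi i h)).1
    · simpa [R, h] using hx0
    · simpa [R, h] using (abs_le.1 (hi i h)).2
  have hvol : volume ((WithLp.ofLp : EuclideanSpace ℝ (Fin N) → Fin N → ℝ) ⁻¹' Icc r R) =
      ENNReal.ofReal (2 * ε * (4 * √ε) ^ (N - 1)) := by
    rw [(PiLp.volume_preserving_ofLp (Fin N)).measure_preimage
      measurableSet_Icc.nullMeasurableSet, Real.volume_Icc_pi,
      ← Finset.mul_prod_erase _ _ (Finset.mem_univ (0 : Fin N)),
      Finset.prod_congr rfl (g := fun _ => ENNReal.ofReal (4 * √ε)), Finset.prod_const,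
      Finset.card_erase_of_mem (Finset.mem_univ _), Finset.card_univ, Fintype.card_fin,
      ENNReal.ofReal_mul (p := 2 * ε) (by positivity),
      ENNReal.ofReal_pow (p := 4 * √ε) (by positivity)]
    · simp [r, R]
    · intro i hi
      have : i ≠ 0 := (Finset.mem_erase.1 hi).1
      simp only [r, R, this, if_false]
      congr 1
      ring
  have hpow : ε * √ε ^ (N - 1) = ε ^ (((N : ℝ) + 1) / 2) := by
    have hN : ((N - 1 : ℕ) : ℝ) = (N : ℝ) - 1 := by
      rw [Nat.cast_sub (Nat.one_le_iff_ne_zero.2 (NeZero.ne N)), Nat.cast_one]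
    rw [Real.sqrt_eq_rpow, ← Real.rpow_natCast, ← Real.rpow_mul hε.le, hN]
    nth_rewrite 1 [← Real.rpow_one ε]
    rw [← Real.rpow_add hε]
    congr 1
    ring
  refine (measureReal_mono hsub (by rw [hvol]; exact ENNReal.ofReal_ne_top)).trans_eq ?_
  rw [measureReal_def, hvol, ENNReal.toReal_ofReal (by positivity), ← hpow, mul_pow]
  ring

lemma exists_volume_real_shell_le {N : ℕ} (hN : 1 ≤ N) {η : ℝ} (hη : 0 < η) :
    ∃ δ > (0 : ℝ), δ ≤ 1 / 8 ∧
      volume.real (ball (0 : EuclideanSpace ℝ (Fin N)) 1 \ ball 0 √(1 - 2 * δ)) ≤ η := by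
  have : Nonempty (Fin N) := ⟨⟨0, hN⟩⟩
  set ω := volume.real (ball (0 : EuclideanSpace ℝ (Fin N)) 1)
  have hball : ∀ r : ℝ, 0 ≤ r → r ≤ 1 →
      volume.real (ball (0 : EuclideanSpace ℝ (Fin N)) 1 \ ball 0 r) = ω - r ^ N * ω := by
    intro r hr hr1
    rw [measureReal_sdiff (ball_subset_ball hr1) measurableSet_ball]
    congr 1
    rw [measureReal_def, Measure.addHaar_ball _ _ hr, ENNReal.toReal_mul,
      ENNReal.toReal_ofReal (by positivity), finrank_euclideanSpace_fin, ← measureReal_def]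
  have hcont : Continuous fun δ : ℝ => ω - √(1 - 2 * δ) ^ N * ω := by fun_prop
  have hlim := hcont.tendsto 0
  simp only [mul_zero, sub_zero, Real.sqrt_one, one_pow, one_mul, sub_self] at hlim
  obtain ⟨d, hd, hdη⟩ := Metric.eventually_nhds_iff.1 (hlim.eventually (gt_mem_nhds hη))
  refine ⟨min (d / 2) (1 / 8), by positivity, min_le_right _ _, ?_⟩
  set δ := min (d / 2) (1 / 8)
  have hδ : 0 < δ := by positivity
  have hδd : δ < d := (min_le_left _ _).trans_lt (by linarith)
  rw [hball _ (Real.sqrt_nonneg _) (Real.sqrt_le_one.2 (by linarith))]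
  exact (hdη (by rwa [Real.dist_eq, sub_zero, abs_of_pos hδ])).le

lemma deriv_smoothTransition_eq_zero {t : ℝ} (ht : t ∉ Icc (0 : ℝ) 1) :
    deriv Real.smoothTransition t = 0 := by
  rw [mem_Icc, not_and_or, not_le, not_le] at ht
  rcases ht with ht | ht
  · have : Real.smoothTransition =ᶠ[nhds t] fun _ => 0 := by
      filter_upwards [gt_mem_nhds ht] with s hs
      exact Real.smoothTransition.zero_of_nonpos hs.le
    rw [this.deriv_eq, deriv_const]
  · have : Real.smoothTransition =ᶠ[nhds t] fun _ => 1 := by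
      filter_upwards [lt_mem_nhds ht] with s hs
      exact Real.smoothTransition.one_of_one_le hs.le
    rw [this.deriv_eq, deriv_const]

lemma exists_abs_deriv_smoothTransition_le :
    ∃ K > (0 : ℝ), ∀ t, |deriv Real.smoothTransition t| ≤ K := by
  have hc : Continuous (deriv Real.smoothTransition) :=
    (Real.smoothTransition.contDiff (n := 1)).continuous_deriv le_rfl
  obtain ⟨C, hC⟩ := isCompact_Icc.exists_bound_of_continuousOn (s := Icc (0 : ℝ) 1) hc.continuousOn
  refine ⟨max C 1, by positivity, fun t => ?_⟩
  by_cases ht : t ∈ Icc (0 : ℝ) 1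
  · exact (hC t ht).trans (le_max_left _ _)
  · rw [deriv_smoothTransition_eq_zero ht, abs_zero]
    positivity

lemma exists_abs_le_mul_one_sub {F : ℝ → ℝ} (hF : ContDiff ℝ 1 F) (h1 : F 1 = 0) :
    ∃ C > (0 : ℝ), ∀ s ∈ Icc (0 : ℝ) 1, |F s| ≤ C * (1 - s) := by
  obtain ⟨C, hC⟩ := isCompact_Icc.exists_bound_of_continuousOn (s := Icc (0 : ℝ) 1)
    (hF.continuous_deriv le_rfl).continuousOn
  refine ⟨max C 1, by positivity, fun s hs => ?_⟩
  have h := (convex_Icc (0 : ℝ) 1).norm_image_sub_le_of_norm_deriv_le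
    (fun t _ => hF.differentiable one_ne_zero t)
    (fun t ht => (hC t ht).trans (le_max_left C 1)) (right_mem_Icc.2 zero_le_one) hs
  rw [h1, sub_zero, Real.norm_eq_abs, Real.norm_eq_abs, abs_sub_comm,
    abs_of_nonneg (sub_nonneg.2 hs.2)] at h
  exact h

/-- A smooth cutoff which vanishes near `{‖x‖ = 1}` and near `{x₀ = -1 + ε}`. -/
def capCutoff (N : ℕ) [NeZero N] (ε δ : ℝ) (x : EuclideanSpace ℝ (Fin N)) : ℝ :=
  Real.smoothTransition ((1 - ‖x‖ ^ 2) / δ - 1) *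
    Real.smoothTransition (2 * (x 0 + 1 - ε) / ε - 1)

lemma contDiff_capCutoff (N : ℕ) [NeZero N] (ε δ : ℝ) :
    ContDiff ℝ (⊤ : ℕ∞) (capCutoff N ε δ) := by
  have h1 : ContDiff ℝ (⊤ : ℕ∞) fun x : EuclideanSpace ℝ (Fin N) => (1 - ‖x‖ ^ 2) / δ - 1 :=
    ((contDiff_const.sub (contDiff_norm_sq ℝ)).div_const δ).sub contDiff_const
  have h2 : ContDiff ℝ (⊤ : ℕ∞)
      fun x : EuclideanSpace ℝ (Fin N) => 2 * (x 0 + 1 - ε) / ε - 1 := by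
    have : ContDiff ℝ (⊤ : ℕ∞) fun x : EuclideanSpace ℝ (Fin N) => x 0 :=
      (EuclideanSpace.proj (𝕜 := ℝ) (0 : Fin N)).contDiff
    exact ((contDiff_const.mul ((this.add contDiff_const).sub contDiff_const)).div_const ε).sub
      contDiff_const
  exact (Real.smoothTransition.contDiff.comp h1).mul (Real.smoothTransition.contDiff.comp h2)

lemma tsupport_capCutoff_subset (N : ℕ) [NeZero N] {ε δ : ℝ} (hε : 0 < ε) (hδ : 0 < δ) :
    tsupport (capCutoff N ε δ) ⊆ {x | ‖x‖ ^ 2 ≤ 1 - δ} ∩ {x | -1 + 3 / 2 * ε ≤ x 0} := by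
  refine closure_minimal (fun x hx => ?_) (.inter (isClosed_le (by fun_prop) (by fun_prop))
    (isClosed_le (by fun_prop) (by fun_prop)))
  have hx' : capCutoff N ε δ x ≠ 0 := hx
  simp only [capCutoff, ne_eq, mul_eq_zero, not_or, Real.smoothTransition.zero_iff_nonpos,
    not_le, sub_pos] at hx'
  obtain ⟨h1, h2⟩ := hx'
  rw [lt_div_iff₀ hδ] at h1
  rw [lt_div_iff₀ hε] at h2
  exact ⟨by simp only [mem_ofPred_eq]; linarith, by simp only [mem_ofPred_eq]; linarith⟩

lemma hasCompactSupport_capCutoff (N : ℕ) [NeZero N] {ε δ : ℝ} (hε : 0 < ε) (hδ : 0 < δ) :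
    HasCompactSupport (capCutoff N ε δ) := by
  refine (isCompact_closedBall (0 : EuclideanSpace ℝ (Fin N)) 1).of_isClosed_subset
    (isClosed_tsupport _) fun x hx => ?_
  have h : ‖x‖ ^ 2 ≤ 1 - δ := (tsupport_capCutoff_subset N hε hδ hx).1
  rw [mem_closedBall_zero_iff]
  nlinarith [norm_nonneg x]

lemma capCutoff_eq_one {N : ℕ} [NeZero N] {ε δ : ℝ} (hε : 0 < ε) (hε2 : ε ≤ 1 / 4) (hδ : 0 < δ)
    (hδ2 : δ ≤ 1 / 8) {x : EuclideanSpace ℝ (Fin N)} (hx : ‖x‖ ≤ 1 / 2) :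
    capCutoff N ε δ x = 1 := by
  have hx0 : |x 0| ≤ 1 / 2 := (PiLp.norm_apply_le x 0).trans hx
  rw [capCutoff, Real.smoothTransition.one_of_one_le, Real.smoothTransition.one_of_one_le, mul_one]
  · rw [le_sub_iff_add_le, le_div_iff₀ hε]
    linarith [(abs_le.1 hx0).1]
  · rw [le_sub_iff_add_le, le_div_iff₀ hδ]
    nlinarith [norm_nonneg x]

lemma norm_fderiv_capCutoff_le {N : ℕ} [NeZero N] {ε δ : ℝ} (hε : 0 < ε) (hδ : 0 < δ)
    (x : EuclideanSpace ℝ (Fin N)) :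
    ‖fderiv ℝ (capCutoff N ε δ) x‖ ≤
      Real.smoothTransition ((1 - ‖x‖ ^ 2) / δ - 1) *
        (|deriv Real.smoothTransition (2 * (x 0 + 1 - ε) / ε - 1)| * (2 / ε)) +
      |deriv Real.smoothTransition ((1 - ‖x‖ ^ 2) / δ - 1)| * (2 * ‖x‖ / δ) := by
  have hT : Differentiable ℝ Real.smoothTransition :=
    (Real.smoothTransition.contDiff (n := 1)).differentiable one_ne_zero
  have ha : HasFDerivAt (fun x : EuclideanSpace ℝ (Fin N) => (1 - ‖x‖ ^ 2) / δ - 1)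
      (δ⁻¹ • (-(2 • innerSL ℝ x) : EuclideanSpace ℝ (Fin N) →L[ℝ] ℝ)) x := by
    have := (((hasStrictFDerivAt_norm_sq x).hasFDerivAt.const_sub 1).const_mul δ⁻¹).sub_const 1
    exact this.congr_of_eventuallyEq (.of_forall fun y => by ring)
  have hb : HasFDerivAt (fun x : EuclideanSpace ℝ (Fin N) => 2 * (x 0 + 1 - ε) / ε - 1)
      ((2 / ε) • EuclideanSpace.proj (𝕜 := ℝ) (0 : Fin N)) x := by
    have := (((EuclideanSpace.proj (𝕜 := ℝ) (0 : Fin N)).hasFDerivAt (x := x)).const_mul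
      (2 / ε)).add_const (2 / ε * (1 - ε) - 1)
    exact this.congr_of_eventuallyEq (.of_forall fun y => by simp; ring)
  have hw := ((hT _).hasDerivAt.comp_hasFDerivAt x ha).mul ((hT _).hasDerivAt.comp_hasFDerivAt x hb)
  have hna : ‖δ⁻¹ • (-(2 • innerSL ℝ x) : EuclideanSpace ℝ (Fin N) →L[ℝ] ℝ)‖ ≤ 2 * ‖x‖ / δ := by
    rw [norm_smul, norm_neg, Real.norm_eq_abs, abs_of_pos (inv_pos.2 hδ), ← Nat.cast_smul_eq_nsmul ℝ,
      norm_smul, innerSL_apply_norm]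
    refine le_of_eq ?_
    simp
    ring
  have hnb : ‖(2 / ε) • EuclideanSpace.proj (𝕜 := ℝ) (0 : Fin N)‖ ≤ 2 / ε := by
    rw [norm_smul, Real.norm_eq_abs, abs_of_pos (by positivity)]
    refine mul_le_of_le_one_right (by positivity) ?_
    refine ContinuousLinearMap.opNorm_le_bound _ zero_le_one fun y => ?_
    rw [one_mul]
    exact PiLp.norm_apply_le y 0
  have hfd : fderiv ℝ (capCutoff N ε δ) x = _ := hw.fderiv
  rw [hfd]
  refine (norm_add_le _ _).trans (add_le_add ?_ ?_)
  · rw [norm_smul, norm_smul, Real.norm_eq_abs, Real.norm_eq_abs]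
    simp only [Function.comp_apply]
    rw [abs_of_nonneg (Real.smoothTransition.nonneg _)]
    have := Real.smoothTransition.nonneg ((1 - ‖x‖ ^ 2) / δ - 1)
    gcongr
  · rw [norm_smul, norm_smul, Real.norm_eq_abs, Real.norm_eq_abs]
    simp only [Function.comp_apply]
    rw [abs_of_nonneg (Real.smoothTransition.nonneg _)]
    refine (mul_le_of_le_one_left (by positivity) (Real.smoothTransition.le_one _)).trans ?_
    gcongr

lemma sq_mul_sq_norm_fderiv_capCutoff_le {N : ℕ} [NeZero N] {F : ℝ → ℝ} {C K ε δ : ℝ}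
    (hC : 0 < C) (hF : ∀ s ∈ Icc (0 : ℝ) 1, |F s| ≤ C * (1 - s)) (hK : 0 < K)
    (hKT : ∀ t, |deriv Real.smoothTransition t| ≤ K) (hε : 0 < ε) (hε2 : ε ≤ 1 / 2) (hδ : 0 < δ)
    (x : EuclideanSpace ℝ (Fin N)) :
    F (‖x‖ ^ 2) ^ 2 * ‖fderiv ℝ (capCutoff N ε δ) x‖ ^ 2 ≤
      (ball 0 1 ∩ {x : EuclideanSpace ℝ (Fin N) | x 0 ≤ -1 + 2 * ε}).indicator
        (fun _ => 128 * C ^ 2 * K ^ 2) x +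
      (ball 0 1 \ ball 0 √(1 - 2 * δ)).indicator (fun _ => 128 * C ^ 2 * K ^ 2) x := by
  have hgrad := norm_fderiv_capCutoff_le hε hδ x
  have hind : ∀ s : Set (EuclideanSpace ℝ (Fin N)),
      0 ≤ s.indicator (fun _ => 128 * C ^ 2 * K ^ 2) x := fun s =>
    indicator_nonneg (fun _ _ => by positivity) x
  set T := Real.smoothTransition ((1 - ‖x‖ ^ 2) / δ - 1)
  set P := |deriv Real.smoothTransition ((1 - ‖x‖ ^ 2) / δ - 1)|
  set Q := |deriv Real.smoothTransition (2 * (x 0 + 1 - ε) / ε - 1)|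
  have hT0 : 0 ≤ T := Real.smoothTransition.nonneg _
  have hT1 : T ≤ 1 := Real.smoothTransition.le_one _
  by_cases hx : x ∈ ball (0 : EuclideanSpace ℝ (Fin N)) 1
  · have hxn := mem_ball_zero_iff.1 hx
    have hx1 : ‖x‖ ^ 2 < 1 := by nlinarith [norm_nonneg x]
    have hFx := hF (‖x‖ ^ 2) ⟨by positivity, hx1.le⟩
    have hq : |F (‖x‖ ^ 2)| * (T * (Q * (2 / ε))) ≤
        (ball 0 1 ∩ {x : EuclideanSpace ℝ (Fin N) | x 0 ≤ -1 + 2 * ε}).indicator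
          (fun _ => 8 * C * K) x := by
      by_cases hQ : 2 * (x 0 + 1 - ε) / ε - 1 ∈ Icc (0 : ℝ) 1
      · have h2 := hQ.2
        rw [sub_le_iff_le_add, div_le_iff₀ hε] at h2
        have hcap : x 0 ≤ -1 + 2 * ε := by linarith
        rw [indicator_of_mem (show x ∈ _ ∩ _ from ⟨hx, hcap⟩)]
        have hx0 : x 0 ^ 2 ≤ ‖x‖ ^ 2 := by
          rw [← sq_abs]
          gcongr
          exact PiLp.norm_apply_le x 0
        have hd : 1 - ‖x‖ ^ 2 ≤ 4 * ε := by nlinarith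
        calc |F (‖x‖ ^ 2)| * (T * (Q * (2 / ε))) ≤ (C * (4 * ε)) * (1 * (K * (2 / ε))) := by
              gcongr
              · exact hFx.trans (by gcongr)
              · exact hKT _
          _ = 8 * C * K := by field_simp; norm_num
      · have : Q = 0 := by simp only [Q, deriv_smoothTransition_eq_zero hQ, abs_zero]
        rw [this, zero_mul, mul_zero, mul_zero]
        exact indicator_nonneg (fun _ _ => by positivity) x
    have hp : |F (‖x‖ ^ 2)| * (P * (2 * ‖x‖ / δ)) ≤
        (ball 0 1 \ ball 0 √(1 - 2 * δ)).indicator (fun _ => 8 * C * K) x := by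
      by_cases hP : (1 - ‖x‖ ^ 2) / δ - 1 ∈ Icc (0 : ℝ) 1
      · have h2 := hP.2
        rw [sub_le_iff_le_add, div_le_iff₀ hδ] at h2
        have hshell : x ∉ ball (0 : EuclideanSpace ℝ (Fin N)) √(1 - 2 * δ) := by
          rw [mem_ball_zero_iff, not_lt]
          exact Real.sqrt_le_iff.2 ⟨norm_nonneg x, by linarith⟩
        rw [indicator_of_mem (show x ∈ _ \ _ from ⟨hx, hshell⟩)]
        calc |F (‖x‖ ^ 2)| * (P * (2 * ‖x‖ / δ)) ≤ (C * (2 * δ)) * (K * (2 * 1 / δ)) := by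
              gcongr
              · exact hFx.trans (by gcongr; linarith)
              · exact hKT _
          _ = 4 * C * K := by field_simp; norm_num
          _ ≤ 8 * C * K := by gcongr; norm_num
      · have : P = 0 := by simp only [P, deriv_smoothTransition_eq_zero hP, abs_zero]
        rw [this, zero_mul, mul_zero]
        exact indicator_nonneg (fun _ _ => by positivity) x
    have hsum : |F (‖x‖ ^ 2)| * ‖fderiv ℝ (capCutoff N ε δ) x‖ ≤ _ :=
      (mul_le_mul_of_nonneg_left hgrad (abs_nonneg _)).trans_eq (mul_add _ _ _)
    have hsq : ∀ s : Set (EuclideanSpace ℝ (Fin N)),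
        2 * s.indicator (fun _ => 8 * C * K) x ^ 2 = s.indicator (fun _ => 128 * C ^ 2 * K ^ 2) x := by
      intro s
      by_cases hs : x ∈ s
      · simp only [indicator_of_mem hs]
        ring
      · simp [indicator_of_notMem hs]
    rw [← hsq, ← hsq, ← sq_abs (F _), ← mul_pow]
    refine (pow_le_pow_left₀ (by positivity) (hsum.trans (add_le_add hq hp)) 2).trans ?_
    rw [← mul_add]
    exact add_sq_le
  · have hxn : 1 ≤ ‖x‖ := by simpa using hx
    have hneg : (1 - ‖x‖ ^ 2) / δ - 1 < 0 := by
      have : (1 - ‖x‖ ^ 2) / δ ≤ 0 := div_nonpos_of_nonpos_of_nonneg (by nlinarith) hδ.le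
      linarith
    have hT : T = 0 := Real.smoothTransition.zero_of_nonpos hneg.le
    have hP : P = 0 := by
      simp only [P, deriv_smoothTransition_eq_zero fun h : _ ∈ Icc (0 : ℝ) 1 => hneg.not_ge h.1,
        abs_zero]
    rw [hT, hP, zero_mul, zero_mul, add_zero] at hgrad
    rw [le_antisymm hgrad (norm_nonneg _)]
    simpa using add_nonneg (hind _) (hind _)

lemma rayleigh_mul_capCutoff_le {N : ℕ} [NeZero N] {F : ℝ → ℝ} {m C K ε δ : ℝ}
    (hFs : ContDiff ℝ (⊤ : ℕ∞) F) (hpos : ∀ s ∈ Ico (0 : ℝ) 1, 0 < F s)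
    (hode : ∀ s, 4 * s * deriv (deriv F) s + 2 * N * deriv F s = -(m * F s))
    (hC : 0 < C) (hF : ∀ s ∈ Icc (0 : ℝ) 1, |F s| ≤ C * (1 - s)) (hK : 0 < K)
    (hKT : ∀ t, |deriv Real.smoothTransition t| ≤ K) (hε : 0 < ε) (hε2 : ε ≤ 1 / 4) (hδ : 0 < δ)
    (hδ2 : δ ≤ 1 / 8) :
    0 < ∫ x in ball (0 : EuclideanSpace ℝ (Fin N)) (1 / 2), F (‖x‖ ^ 2) ^ 2 ∧
    rayleigh N (fun x => F (‖x‖ ^ 2) * capCutoff N ε δ x) ≤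
      m + 128 * C ^ 2 * K ^ 2 *
        (volume.real (ball (0 : EuclideanSpace ℝ (Fin N)) 1 ∩ {x | x 0 ≤ -1 + 2 * ε}) +
          volume.real (ball (0 : EuclideanSpace ℝ (Fin N)) 1 \ ball 0 √(1 - 2 * δ))) /
        ∫ x in ball (0 : EuclideanSpace ℝ (Fin N)) (1 / 2), F (‖x‖ ^ 2) ^ 2 := by
  have hF2 : ContDiff ℝ 2 F := by exact_mod_cast contDiff_infty.1 hFs 2
  have hu : ContDiff ℝ 2 fun x : EuclideanSpace ℝ (Fin N) => F (‖x‖ ^ 2) :=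
    hF2.comp (contDiff_norm_sq ℝ)
  have hw := contDiff_capCutoff N ε δ
  have hwc := hasCompactSupport_capCutoff N hε hδ
  have hid := integral_sq_norm_fderiv_mul volume (EuclideanSpace.basisFun (Fin N) ℝ) (m := m) hu
    (hw.of_le (by exact_mod_cast le_top)) hwc fun x => by
      rw [sum_fderiv_fderiv_radial _ hF2, Fintype.card_fin]
      exact hode _
  set D := ∫ x in ball (0 : EuclideanSpace ℝ (Fin N)) (1 / 2), F (‖x‖ ^ 2) ^ 2
  have hwint : Integrable fun x => (F (‖x‖ ^ 2) * capCutoff N ε δ x) ^ 2 := by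
    refine ((hu.continuous.mul hw.continuous).pow 2).integrable_of_hasCompactSupport ?_
    refine hwc.mono fun x hx => ?_
    contrapose! hx
    simp only [Function.mem_support, not_not] at hx
    simp [hx]
  have hDle : D ≤ ∫ x, (F (‖x‖ ^ 2) * capCutoff N ε δ x) ^ 2 := by
    have : D = ∫ x in ball (0 : EuclideanSpace ℝ (Fin N)) (1 / 2),
        (F (‖x‖ ^ 2) * capCutoff N ε δ x) ^ 2 := by
      refine setIntegral_congr_fun measurableSet_ball fun x hx => ?_
      simp only [capCutoff_eq_one hε hε2 hδ hδ2 (mem_ball_zero_iff.1 hx).le, mul_one]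
    rw [this]
    exact setIntegral_le_integral hwint (.of_forall fun x => sq_nonneg _)
  have hDpos : 0 < D := by
    have hsub : ball (0 : EuclideanSpace ℝ (Fin N)) (1 / 2) ⊆
        Function.support fun x => F (‖x‖ ^ 2) ^ 2 := by
      intro x hx
      have hx := mem_ball_zero_iff.1 hx
      exact pow_ne_zero 2 (hpos _ ⟨by positivity, by nlinarith [norm_nonneg x]⟩).ne'
    refine (setIntegral_pos_iff_support_of_nonneg_ae (.of_forall fun x => sq_nonneg _) ?_).2 ?_
    · exact ((hu.continuous.pow 2).continuousOn.integrableOn_compact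
        (isCompact_closedBall 0 (1 / 2))).mono_set ball_subset_closedBall
    · rw [inter_eq_self_of_subset_right hsub]
      exact measure_ball_pos _ _ (by norm_num)
  refine ⟨hDpos, ?_⟩
  have hcapm : MeasurableSet (ball (0 : EuclideanSpace ℝ (Fin N)) 1 ∩ {x | x 0 ≤ -1 + 2 * ε}) :=
    measurableSet_ball.inter (isClosed_le (by fun_prop) (by fun_prop)).measurableSet
  have hshellm : MeasurableSet (ball (0 : EuclideanSpace ℝ (Fin N)) 1 \ ball 0 √(1 - 2 * δ)) :=
    measurableSet_ball.diff measurableSet_ball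
  have hfin : ∀ s ⊆ ball (0 : EuclideanSpace ℝ (Fin N)) 1, volume s ≠ ⊤ := fun s hs =>
    ((measure_mono hs).trans_lt measure_ball_lt_top).ne
  have hcapi := integrable_indicator_iff hcapm |>.2
    (integrableOn_const (C := 128 * C ^ 2 * K ^ 2) (hfin _ inter_subset_left))
  have hshelli := integrable_indicator_iff hshellm |>.2
    (integrableOn_const (C := 128 * C ^ 2 * K ^ 2) (hfin _ sdiff_subset))
  have hnum : ∫ x, F (‖x‖ ^ 2) ^ 2 * ‖fderiv ℝ (capCutoff N ε δ) x‖ ^ 2 ≤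
      128 * C ^ 2 * K ^ 2 *
        (volume.real (ball (0 : EuclideanSpace ℝ (Fin N)) 1 ∩ {x | x 0 ≤ -1 + 2 * ε}) +
          volume.real (ball (0 : EuclideanSpace ℝ (Fin N)) 1 \ ball 0 √(1 - 2 * δ))) := by
    refine (integral_mono_of_nonneg (.of_forall fun x => by positivity) (hcapi.add hshelli)
      (.of_forall fun x => sq_mul_sq_norm_fderiv_capCutoff_le hC hF hK hKT hε (by linarith) hδ x)
      ).trans_eq ?_
    rw [integral_add' hcapi hshelli, integral_indicator_const _ hcapm,
      integral_indicator_const _ hshellm, smul_eq_mul, smul_eq_mul]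
    ring
  have hI := hDpos.trans_le hDle
  rw [rayleigh, hid, add_div, mul_div_assoc, div_self hI.ne', mul_one]
  gcongr

lemma mul_capCutoff_mem_testFun {N : ℕ} [NeZero N] {F : ℝ → ℝ} (hF : ContDiff ℝ (⊤ : ℕ∞) F)
    {ε δ : ℝ} (hε : 0 < ε) (hδ : 0 < δ) :
    (fun x => F (‖x‖ ^ 2) * capCutoff N ε δ x) ∈
      testFun N (ball 0 1 ∩ {x | -1 + ε < x 0}) := by
  refine ⟨(hF.comp (contDiff_norm_sq ℝ)).mul (contDiff_capCutoff N ε δ),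
    (hasCompactSupport_capCutoff N hε hδ).mul_left, ?_⟩
  refine (tsupport_mul_subset_right.trans (tsupport_capCutoff_subset N hε hδ)).trans ?_
  rintro x ⟨h1, h2⟩
  simp only [mem_ofPred_eq] at h1 h2
  refine ⟨?_, ?_⟩
  · rw [mem_ball_zero_iff]
    nlinarith [norm_nonneg x]
  · simp only [mem_ofPred_eq]
    linarith

/-- For `Ω_ε⁺ = B((1-ε,0),1) ∩ {x₁ > 0}`, there is `γ > 0` with
`λ₁(Ω_ε⁺) ≤ λ₁(B) + γ ε^{(N+1)/2}` for all small `ε > 0`. -/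
theorem stmt_10 (N : ℕ) [NeZero N] (hN : 2 ≤ N) :
    ∃ γ > (0 : ℝ), ∃ ε₀ > (0 : ℝ), ∀ ε ∈ Ioo (0 : ℝ) ε₀,
      dirichletEV N 1
          (ball (EuclideanSpace.single (0 : Fin N) (1 - ε)) 1 ∩ {x | 0 < x 0}) ≤
        dirichletEV N 1 (ball (0 : EuclideanSpace ℝ (Fin N)) 1) +
          γ * ε ^ (((N : ℝ) + 1) / 2) := by
  have hN1 : 1 ≤ N := one_le_two.trans hN
  obtain ⟨F, m, hFs, hF1, hpos, hode⟩ := exists_ground_state_profile hN1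
  obtain ⟨C, hC, hF⟩ := exists_abs_le_mul_one_sub (hFs.of_le (by exact_mod_cast le_top)) hF1
  obtain ⟨K, hK, hKT⟩ := exists_abs_deriv_smoothTransition_le
  have hlower : m ≤ dirichletEV N 1 (ball (0 : EuclideanSpace ℝ (Fin N)) 1) :=
    le_dirichletEV_one_of_forall (exists_testFun_ne_zero N) fun φ hφ hφ0 =>
      (le_div_iff₀ (integral_sq_pos_of_mem_testFun hφ hφ0)).2
        (mul_integral_sq_le_of_radial_pos hFs hpos hode hφ)
  set D := ∫ x in ball (0 : EuclideanSpace ℝ (Fin N)) (1 / 2), F (‖x‖ ^ 2) ^ 2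
  have hD : 0 < D := (rayleigh_mul_capCutoff_le hFs hpos hode hC hF hK hKT
    (ε := 1 / 4) (δ := 1 / 8) (by norm_num) le_rfl (by norm_num) le_rfl).1
  refine ⟨128 * C ^ 2 * K ^ 2 * (2 * 4 ^ (N - 1) + 1) / D, by positivity, 1 / 4, by norm_num,
    fun ε hε => ?_⟩
  obtain ⟨hε0, hε1⟩ := hε
  obtain ⟨δ, hδ, hδ2, hshell⟩ := exists_volume_real_shell_le hN1
    (Real.rpow_pos_of_pos hε0 (((N : ℝ) + 1) / 2))
  have hray := (rayleigh_mul_capCutoff_le hFs hpos hode hC hF hK hKT hε0 hε1.le hδ hδ2).2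
  have hcap := volume_real_cap_le (N := N) hε0 (by linarith)
  set c : EuclideanSpace ℝ (Fin N) := EuclideanSpace.single 0 (1 - ε)
  have hmem := comp_sub_mem_testFun (mul_capCutoff_mem_testFun (N := N) hFs hε0 hδ) c
  have hset : (fun x => x - c) ⁻¹' (ball 0 1 ∩ {x | -1 + ε < x 0}) =
      ball c 1 ∩ {x : EuclideanSpace ℝ (Fin N) | 0 < x 0} := by
    ext x
    simp only [mem_preimage, mem_inter_iff, mem_ball_iff_norm, sub_zero, mem_ofPred_eq]
    refine and_congr_right fun _ => ?_
    simp only [c, PiLp.sub_apply, PiLp.single_apply, if_true]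
    constructor <;> intro h <;> linarith
  rw [hset] at hmem
  have hne : (fun x => F (‖x - c‖ ^ 2) * capCutoff N ε δ (x - c)) ≠ 0 := by
    intro h
    have h0 := congrFun h c
    simp only [sub_self, Pi.zero_apply] at h0
    rw [capCutoff_eq_one hε0 hε1.le hδ hδ2 (by norm_num), mul_one] at h0
    refine (hpos (‖(0 : EuclideanSpace ℝ (Fin N))‖ ^ 2) (by simp)).ne' h0
  calc _ ≤ rayleigh N fun x => F (‖x - c‖ ^ 2) * capCutoff N ε δ (x - c) :=
        dirichletEV_one_le_rayleigh hmem hne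
    _ = rayleigh N fun x => F (‖x‖ ^ 2) * capCutoff N ε δ x :=
        rayleigh_comp_sub (fun x => F (‖x‖ ^ 2) * capCutoff N ε δ x) c
    _ ≤ m + 128 * C ^ 2 * K ^ 2 * (2 * 4 ^ (N - 1) * ε ^ (((N : ℝ) + 1) / 2) +
          ε ^ (((N : ℝ) + 1) / 2)) / D := hray.trans (by gcongr)
    _ = m + 128 * C ^ 2 * K ^ 2 * (2 * 4 ^ (N - 1) + 1) / D * ε ^ (((N : ℝ) + 1) / 2) := by ring
    _ ≤ _ := by gcongr
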